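/- arXiv:1510.00971 — 3 statements merged into one kernel-verified Lean document; each statement's English description precedes it below -/
import Mathlib

section
/- Let n ≥ 1 and let C be an n×n complex matrix. If x : ℝ → ℂⁿ is differentiable and satisfies x'(t) = C·x(t) for all t ∈ ℝ, then there exist a finite set S of eigenvalues of C (i.e. S ⊆ spectrum ℂ C) and, for each μ ∈ S, a vector of polynomials p_μ ∈ (ℂ[t])ⁿ each of degree < n, such that x(t) = Σ_{μ ∈ S} e^{μt} · (p_μ evaluated at t) for every t ∈ ℝ. In other words, every solution of the constant-coefficient linear system x' = Cx is a finite linear combination of exponential-polynomial solutions e^{μt}·(polynomial in t), where μ ranges over eigenvalues of C. -/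
lemma hasDerivAt_expSum {n : ℕ} (w : ℕ → (Fin n → ℂ)) (m : ℕ) (t : ℝ) :
    HasDerivAt (fun s : ℝ => ∑ k ∈ Finset.range (m + 1), ((s : ℂ) ^ k / (k.factorial : ℂ)) • w k)
      (∑ k ∈ Finset.range m, ((t : ℂ) ^ k / (k.factorial : ℂ)) • w (k + 1)) t := by
  induction m with
  | zero => simpa using hasDerivAt_const t (w 0)
  | succ m ih =>
    have h1 : HasDerivAt (fun s : ℝ => (s : ℂ) ^ (m + 1) / ((m + 1).factorial : ℂ))
        ((t : ℂ) ^ m / (m.factorial : ℂ)) t := by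
      have h2 := (((hasDerivAt_id (t : ℂ)).pow (m + 1)).div_const ((m + 1).factorial : ℂ)).comp_ofReal
      refine h2.congr_deriv ?_
      have : (m.factorial : ℂ) ≠ 0 := by exact_mod_cast m.factorial_ne_zero
      have h3 : (m : ℂ) + 1 ≠ 0 := by exact_mod_cast m.succ_ne_zero
      simp [Nat.factorial_succ]
      field_simp
    have h4 := ih.add (h1.smul_const (w (m + 1)))
    rw [Finset.sum_range_succ _ m]
    refine h4.congr_of_eventuallyEq (Filter.Eventually.of_forall fun s => ?_)
    simp [Finset.sum_range_succ _ (m + 1)]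

theorem euler_theorem (n : ℕ) (hn : 1 ≤ n) (C : Matrix (Fin n) (Fin n) ℂ)
    (x : ℝ → (Fin n → ℂ)) (hx : Differentiable ℝ x)
    (hode : ∀ t : ℝ, deriv x t = C.mulVec (x t)) :
    ∃ S : Finset ℂ, (↑S : Set ℂ) ⊆ spectrum ℂ C ∧
      ∃ p : ℂ → (Fin n → Polynomial ℂ),
        (∀ μ ∈ S, ∀ i : Fin n, (p μ i).degree < (n : ℕ)) ∧
        ∀ (t : ℝ) (i : Fin n),
          x t i = ∑ μ ∈ S, Complex.exp (μ * t) * (p μ i).eval (t : ℂ) := by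
  set f : Module.End ℂ (Fin n → ℂ) := Matrix.toLin' C with hf
  have hmem : x 0 ∈ ⨆ μ, f.maxGenEigenspace μ := by
    rw [Module.End.iSup_maxGenEigenspace_eq_top]; trivial
  obtain ⟨v, hv, hvs⟩ := (Submodule.mem_iSup_iff_exists_finsupp _ _).1 hmem
  have hNn : ∀ μ, ((f - μ • (1 : Module.End ℂ (Fin n → ℂ))) ^ n) (v μ) = 0 := by
    intro μ
    have h := hv μ
    rw [Module.End.maxGenEigenspace_eq_genEigenspace_finrank, Module.finrank_fin_fun] at h
    simpa [Module.End.mem_genEigenspace_nat] using h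
  let w : ℂ → ℕ → (Fin n → ℂ) := fun μ k => ((f - μ • (1 : Module.End ℂ (Fin n → ℂ))) ^ k) (v μ)
  have hw : ∀ μ k, C.mulVec (w μ k) = μ • w μ k + w μ (k + 1) := by
    intro μ k
    simp only [w, pow_succ', Module.End.mul_apply]
    simp [hf]
  let u : ℂ → ℝ → (Fin n → ℂ) := fun μ s =>
    ∑ k ∈ Finset.range n, ((s : ℂ) ^ k / (k.factorial : ℂ)) • w μ k
  have hu : ∀ (μ : ℂ) (t : ℝ), HasDerivAt (u μ)
      (∑ k ∈ Finset.range n, ((t : ℂ) ^ k / (k.factorial : ℂ)) • w μ (k + 1)) t := by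
    intro μ t
    obtain ⟨m, rfl⟩ : ∃ m, n = m + 1 := ⟨n - 1, by omega⟩
    rw [Finset.sum_range_succ]
    have : w μ (m + 1) = 0 := hNn μ
    rw [this, smul_zero, add_zero]
    exact hasDerivAt_expSum (w μ) m t
  have hz : ∀ (μ : ℂ) (t : ℝ), HasDerivAt (fun s : ℝ => Complex.exp (μ * s) • u μ s)
      (C.mulVec (Complex.exp (μ * t) • u μ t)) t := by
    intro μ t
    have he : HasDerivAt (fun s : ℝ => Complex.exp (μ * s)) (Complex.exp (μ * t) * μ) t := by
      have := (((hasDerivAt_id (t : ℂ)).const_mul μ).cexp).comp_ofReal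
      simpa using this
    refine (he.smul (hu μ t)).congr_deriv ?_
    symm
    rw [Matrix.mulVec_smul, mul_smul, ← smul_add]
    congr 1
    simp only [u, Matrix.mulVec_sum, Matrix.mulVec_smul, hw, Finset.smul_sum,
      ← Finset.sum_add_distrib]
    refine Finset.sum_congr rfl fun k _ => ?_
    rw [smul_add, smul_comm, add_comm]
  have hy : ∀ t : ℝ, HasDerivAt (fun s : ℝ => ∑ μ ∈ v.support, Complex.exp (μ * s) • u μ s)
      (C.mulVec (∑ μ ∈ v.support, Complex.exp (μ * t) • u μ t)) t := by
    intro t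
    rw [Matrix.mulVec_sum]
    exact HasDerivAt.fun_sum fun μ _ => hz μ t
  have hu0 : ∀ μ, u μ 0 = v μ := by
    intro μ
    simp only [u]
    rw [Finset.sum_eq_single 0]
    · simp [w]
    · intro b _ hb
      simp [hb]
    · intro h
      simp at h
      omega
  have heq : x = fun s : ℝ => ∑ μ ∈ v.support, Complex.exp (μ * s) • u μ s := by
    have hlip := (LinearMap.toContinuousLinearMap f).lipschitz
    refine ODE_solution_unique_univ (v := fun _ y => C.mulVec y) (s := fun _ => Set.univ) (t₀ := 0)
      (fun t => (LipschitzWith.lipschitzOnWith (s := Set.univ) hlip))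
      (fun t => ⟨?_, trivial⟩) (fun t => ⟨hy t, trivial⟩) ?_
    · rw [← hode t]; exact (hx t).hasDerivAt
    · simp only [hu0]
      rw [← hvs]
      simp [Finsupp.sum]
  refine ⟨v.support, ?_, fun μ i => ∑ k ∈ Finset.range n,
    Polynomial.C (w μ k i / (k.factorial : ℂ)) * Polynomial.X ^ k, ?_, ?_⟩
  · intro μ hμ
    have hne : v μ ≠ 0 := by simpa using hμ
    have hE : f.HasEigenvalue μ := by
      by_contra hcon
      have : f.HasUnifEigenvalue μ (⊤ : ℕ∞) := by
        intro hbot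
        have h := hv μ
        rw [Module.End.maxGenEigenspace, hbot] at h
        exact hne (by simpa using h)
      exact hcon (this.lt zero_lt_one)
    have := hE.mem_spectrum
    rwa [hf, Matrix.spectrum_toLin'] at this
  · intro μ _ i
    refine (Polynomial.degree_sum_le _ _).trans_lt ?_
    rw [Finset.sup_lt_iff (by exact WithBot.bot_lt_coe _)]
    intro k hk
    refine (Polynomial.degree_C_mul_X_pow_le _ _).trans_lt ?_
    exact_mod_cast Finset.mem_range.1 hk
  · intro t i
    rw [heq]
    simp only [Finset.sum_apply, Pi.smul_apply, smul_eq_mul, u, Polynomial.eval_finsetSum]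
    refine Finset.sum_congr rfl fun μ _ => ?_
    congr 1
    refine Finset.sum_congr rfl fun k _ => ?_
    simp
    ring
end

section
/- (Lyapunov reduction theorem.) Let n ≥ 1 and let A : ℝ → Mat_{n×n}(ℂ) be continuous and 1-periodic (A(t+1) = A(t) for all t). Then there exist a constant n×n complex matrix C and a differentiable 1-periodic function B : ℝ → Mat_{n×n}(ℂ) with B(t) invertible for every t, such that B'(t) = A(t)·B(t) − B(t)·C for all t ∈ ℝ. (Consequently the substitution x(t) = B(t)·y(t) reduces the periodic system x' = A(t)x to the constant-coefficient system y' = Cy.) -/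
attribute [local instance] Matrix.linftyOpNormedAddCommGroup Matrix.linftyOpNormedRing
  Matrix.linftyOpNormedSpace Matrix.linftyOpNormedAlgebra

open Filter Topology Set

/-- Global solvability of linear ODEs with bounded continuous coefficients. -/
theorem linODE_exists {E : Type*} [NormedAddCommGroup E] [NormedSpace ℝ E] [CompleteSpace E]
    (A : ℝ → E →L[ℝ] E) (hA : Continuous A) (M : ℝ) (hM : ∀ t, ‖A t‖ ≤ M) (x₀ : E) :
    ∃ X : ℝ → E, X 0 = x₀ ∧ ∀ t, HasDerivAt X (A t (X t)) t := by
  have hM0 : 0 ≤ M := (norm_nonneg _).trans (hM 0)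
  let u : ℕ → ℝ → E := fun k => Nat.rec (fun _ => x₀) (fun _ v t => ∫ s in (0:ℝ)..t, A s (v s)) k
  have u0 : u 0 = fun _ => x₀ := rfl
  have us : ∀ k, u (k+1) = fun t => ∫ s in (0:ℝ)..t, A s (u k s) := fun k => rfl
  have step : ∀ k, Continuous (u k) → ∀ t, HasDerivAt (u (k+1)) (A t (u k t)) t := by
    intro k hk t
    rw [us]
    exact (hA.clm_apply hk).integral_hasStrictDerivAt 0 t |>.hasDerivAt
  have hc : ∀ k, Continuous (u k) := by
    intro k
    induction k with
    | zero => rw [u0]; exact continuous_const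
    | succ k ih =>
      exact continuous_iff_continuousAt.2 fun t => (step k ih t).continuousAt
  have hu0 : ∀ k, u (k+1) 0 = 0 := by intro k; rw [us]; simp
  have hb : ∀ k t, ‖u k t‖ ≤ ‖x₀‖ * (M * |t|) ^ k / k.factorial := by
    intro k
    induction k with
    | zero => intro t; simp [u0]
    | succ k ih =>
      intro t
      have key : ∀ s, ‖A s (u k s)‖ ≤ ‖x₀‖ * M ^ (k+1) / k.factorial * |s| ^ k := by
        intro s
        calc ‖A s (u k s)‖ ≤ ‖A s‖ * ‖u k s‖ := (A s).le_opNorm _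
          _ ≤ M * (‖x₀‖ * (M * |s|) ^ k / k.factorial) := by
            gcongr
            · exact hM s
            · exact ih s
          _ = _ := by rw [mul_pow]; ring
      have hint : |∫ s in (0:ℝ)..t, |s| ^ k| = |t| ^ (k+1) / (k+1) := by
        rcases le_total 0 t with h | h
        · have : ∫ s in (0:ℝ)..t, |s| ^ k = ∫ s in (0:ℝ)..t, s ^ k := by
            apply intervalIntegral.integral_congr
            intro s hs
            rw [uIcc_of_le h] at hs
            simp only [abs_of_nonneg hs.1]
          rw [this, integral_pow, abs_of_nonneg h]
          rw [zero_pow (Nat.succ_ne_zero k), sub_zero, abs_of_nonneg (by positivity)]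
        · have : ∫ s in (0:ℝ)..t, |s| ^ k = ∫ s in (0:ℝ)..t, (-1)^k * s ^ k := by
            apply intervalIntegral.integral_congr
            intro s hs
            rw [uIcc_of_ge h] at hs
            simp only [abs_of_nonpos hs.2]
            rw [← mul_pow]; simp
          rw [this, intervalIntegral.integral_const_mul, integral_pow]
          simp [abs_mul, abs_div]
          rw [abs_of_nonneg (by positivity : (0:ℝ) ≤ k + 1)]
      rw [us]
      have h1 := intervalIntegral.norm_integral_le_abs_of_norm_le (μ := MeasureTheory.volume)
        (a := 0) (b := t)
        (f := fun s => A s (u k s)) (g := fun s => ‖x₀‖ * M ^ (k+1) / k.factorial * |s| ^ k)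
        (Eventually.of_forall fun s => key s)
        (Continuous.intervalIntegrable (by fun_prop) _ _)
      refine h1.trans (le_of_eq ?_)
      rw [intervalIntegral.integral_const_mul, abs_mul, hint, abs_of_nonneg (by positivity),
        Nat.factorial_succ]
      push_cast
      rw [mul_pow]
      field_simp
  refine ⟨fun t => ∑' k, u k t, ?_, fun t => ?_⟩
  · show ∑' k, u k 0 = x₀
    refine (tsum_eq_single 0 ?_).trans (congrFun u0 0)
    intro k hk
    obtain ⟨j, rfl⟩ := Nat.exists_eq_succ_of_ne_zero hk
    exact hu0 j
  · have hsum : ∀ T : ℝ, Summable fun k : ℕ => ‖x₀‖ * (M * T) ^ k / k.factorial := by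
      intro T
      simpa [mul_div_assoc] using (Real.summable_pow_div_factorial (M * T)).mul_left ‖x₀‖
    have hsu : ∀ t, Summable fun k => u k t := fun t =>
      Summable.of_norm_bounded (hsum |t|) (fun k => hb k t)
    set T := |t| + 1
    have hd := hasDerivAt_tsum_of_isPreconnected (𝕜 := ℝ)
      (u := fun k : ℕ => M * (‖x₀‖ * (M * T) ^ k / k.factorial))
      (g := fun k t => u (k+1) t) (g' := fun k t => A t (u k t)) (t := Ioo (-T) T) (y₀ := t) (y := t)
      ((hsum T).mul_left M) isOpen_Ioo isPreconnected_Ioo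
      (fun k y _ => step k (hc k) y)
      (fun k y hy => by
        have : |y| ≤ T := abs_le.2 ⟨hy.1.le, hy.2.le⟩
        calc ‖A y (u k y)‖ ≤ ‖A y‖ * ‖u k y‖ := (A y).le_opNorm _
          _ ≤ M * (‖x₀‖ * (M * |y|) ^ k / k.factorial) := by
            gcongr
            · exact hM y
            · exact hb k y
          _ ≤ _ := by gcongr)
      (abs_lt.1 (by simp [T])) ((summable_nat_add_iff 1).2 (hsu t)) (abs_lt.1 (by simp [T]))
    have e : (fun t => ∑' k, u k t) = fun t => x₀ + ∑' k, u (k+1) t := by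
      funext t
      rw [(hsu t).tsum_eq_zero_add, u0]
    have e2 : A t (∑' k, u k t) = ∑' k, A t (u k t) := (A t).map_tsum (hsu t)
    rw [e2, e]
    exact hd.const_add x₀

theorem exists_log {R : Type*} [NormedRing R] [NormedAlgebra ℂ R] [CompleteSpace R]
    (hcomm : ∀ x y : R, x * y = y * x) (m : R) (hm : IsUnit m)
    (hS : {z : ℂ | ¬ IsUnit (1 + z • (m - 1))}.Countable) :
    ∃ c : R, NormedSpace.exp c = m := by
  let _ : NormedAlgebra ℚ R := NormedAlgebra.restrictScalars ℚ ℂ R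
  have hnear : range (NormedSpace.exp : R → R) ∈ 𝓝 (1 : R) := by
    have h := (hasStrictFDerivAt_exp_zero (𝕂 := ℂ) (𝔸 := R)).map_nhds_eq_of_surj
      (by rw [LinearMap.range_eq_top]; exact fun x => ⟨x, rfl⟩)
    rw [NormedSpace.exp_zero] at h
    rw [← h]
    exact mem_map.2 (univ_mem' fun x => mem_range_self x)
  let G : ℂ → R := fun z => 1 + z • (m - 1)
  have hG : Continuous G := by fun_prop
  have hpre := (hS.isPathConnected_compl_of_one_lt_rank
    (by rw [Complex.rank_real_complex]; norm_num)).isConnected.isPreconnected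
  have main := hpre.induction₂ (fun z w => G z ∈ range (NormedSpace.exp : R → R) ↔
      G w ∈ range (NormedSpace.exp : R → R)) ?_ ?_ ?_ (x := 0) (y := 1) ?_ ?_
  · have : G 1 ∈ range (NormedSpace.exp : R → R) := main.1 ⟨0, by simp [G]⟩
    simpa [G] using this
  · intro z hz
    have hu : IsUnit (G z) := by simpa [G] using hz
    obtain ⟨v, hv⟩ := hu
    have ht : Tendsto (fun w => G w * ↑v⁻¹) (𝓝 z) (𝓝 (1 : R)) := by
      have : ContinuousAt (fun w => G w * (↑v⁻¹ : R)) z := by fun_prop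
      have h2 := this.tendsto
      simp only [← hv, Units.mul_inv] at h2
      exact h2
    refine mem_nhdsWithin_of_mem_nhds ?_
    filter_upwards [ht hnear] with w hw
    obtain ⟨l, hl⟩ := hw
    have hl' : G w = NormedSpace.exp l * G z := by rw [hl, mul_assoc, ← hv]; simp
    constructor
    · rintro ⟨c, hc⟩
      exact ⟨l + c, by rw [NormedSpace.exp_add_of_commute (hcomm _ _), hc, hl']⟩
    · rintro ⟨c, hc⟩
      refine ⟨-l + c, ?_⟩
      rw [NormedSpace.exp_add_of_commute (hcomm _ _), hc, hl', ← mul_assoc,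
        ← NormedSpace.exp_add_of_commute (hcomm _ _)]
      simp
  · intro x y z _ _ _ h1 h2; exact h1.trans h2
  · intro x y _ _ h; exact h.symm
  · simp
  · simpa using hm

theorem matrix_exists_log (n : ℕ) (M : Matrix (Fin n) (Fin n) ℂ) (hM : IsUnit M) :
    ∃ C : Matrix (Fin n) (Fin n) ℂ, NormedSpace.exp C = M := by
  let R := Algebra.adjoin ℂ ({M} : Set (Matrix (Fin n) (Fin n) ℂ))
  have hcomm : ∀ x y : R, x * y = y * x :=
    (Algebra.isMulCommutative_adjoin ℂ (s := {M}) (by simp)).is_comm.comm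
  have hunit : ∀ x : R, IsUnit (x : Matrix (Fin n) (Fin n) ℂ) → IsUnit x := by
    intro x hx
    have hinj : Function.Injective (LinearMap.mulLeft ℂ x) := by
      intro a b hab
      apply Subtype.ext
      apply hx.mul_left_cancel
      exact congrArg Subtype.val hab
    obtain ⟨y, hy⟩ := (LinearMap.injective_iff_surjective.1 hinj) 1
    exact ⟨⟨x, y, hy, (hcomm _ _).trans hy⟩, rfl⟩
  let m : R := ⟨M, Algebra.subset_adjoin rfl⟩
  let _ : NormedRing R := inferInstance
  have : @CompleteSpace R PseudoMetricSpace.toUniformSpace :=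
    (Submodule.closed_of_finiteDimensional (𝕜 := ℂ) (Subalgebra.toSubmodule R)).completeSpace_coe
  obtain ⟨c, hc⟩ := exists_log hcomm m (hunit m hM) (by
    refine Set.Countable.mono ?_
      ((Matrix.finite_spectrum (R := ℂ) (M - 1)).image (fun z => -z⁻¹)).countable
    intro z hz
    refine ⟨-z⁻¹, ?_, by simp⟩
    rw [spectrum.mem_iff]
    intro hu
    have hz0 : z ≠ 0 := by rintro rfl; simp at hz
    apply hz
    apply hunit
    have : ((1 + z • (m - 1) : R) : Matrix (Fin n) (Fin n) ℂ)
        = (Units.mk0 (-z) (neg_ne_zero.2 hz0)) • (algebraMap ℂ _ (-z⁻¹) - (M - 1)) := by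
      show (1 + z • (M - 1)) = (-z) • (algebraMap ℂ _ (-z⁻¹) - (M - 1))
      rw [smul_sub (-z), Algebra.algebraMap_eq_smul_one, smul_smul]
      simp [hz0]
    rw [this]
    exact hu.smul _)
  refine ⟨(c : Matrix (Fin n) (Fin n) ℂ), ?_⟩
  let _ : NormedAlgebra ℚ R := NormedAlgebra.restrictScalars ℚ ℂ R
  have h := NormedSpace.map_exp (R.val) continuous_subtype_val c
  rw [hc] at h
  exact h.symm

/-- **Lyapunov reduction theorem**: for a continuous `1`-periodic matrix
function `A`, there is a differentiable `1`-periodic invertible matrix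
function `B` and a constant matrix `C` with `B' = A B − B C`; hence the
substitution `x = B y` reduces `x' = A(t) x` to the constant-coefficient
system `y' = C y`. -/
theorem lyapunov_reduction (n : ℕ) (hn : 1 ≤ n)
    (A : ℝ → Matrix (Fin n) (Fin n) ℂ) (hA : Continuous A)
    (hAper : ∀ t : ℝ, A (t + 1) = A t) :
    ∃ (C : Matrix (Fin n) (Fin n) ℂ) (B : ℝ → Matrix (Fin n) (Fin n) ℂ),
      Differentiable ℝ B ∧
      (∀ t : ℝ, B (t + 1) = B t) ∧
      (∀ t : ℝ, IsUnit (B t)) ∧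
      (∀ t : ℝ, deriv B t = A t * B t - B t * C) := by
  let Mt := Matrix (Fin n) (Fin n) ℂ
  have : CompleteSpace Mt := FiniteDimensional.complete ℂ Mt
  let _ : NormedAlgebra ℝ Mt := NormedAlgebra.restrictScalars ℝ ℂ Mt
  let _ : NormedAlgebra ℚ Mt := NormedAlgebra.restrictScalars ℚ ℂ Mt
  obtain ⟨K, hK⟩ : ∃ K, ∀ t, ‖A t‖ ≤ K := by
    obtain ⟨K, hK⟩ := (isCompact_Icc (a := (0:ℝ)) (b := 1)).exists_bound_of_continuousOn
      hA.continuousOn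
    refine ⟨K, fun t => ?_⟩
    obtain ⟨y, hy, hty⟩ := (show Function.Periodic A 1 from hAper).exists_mem_Ico₀ one_pos t
    rw [hty]
    exact hK y ⟨hy.1, hy.2.le⟩
  obtain ⟨X, hX0, hX⟩ := linODE_exists (E := Mt) (fun t => ContinuousLinearMap.mul ℝ Mt (A t))
    (by fun_prop) K (fun t => (ContinuousLinearMap.opNorm_mul_apply_le ℝ Mt (A t)).trans (hK t)) 1
  obtain ⟨Y, hY0, hY⟩ := linODE_exists (E := Mt)
    (fun t => -((ContinuousLinearMap.mul ℝ Mt).flip (A t)))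
    (by fun_prop) K (fun t => by
      rw [norm_neg]
      refine (ContinuousLinearMap.opNorm_le_bound _ (norm_nonneg _) fun x => ?_).trans (hK t)
      rw [mul_comm]
      exact norm_mul_le _ _) 1
  replace hX : ∀ t, HasDerivAt X (A t * X t) t := hX
  replace hY : ∀ t, HasDerivAt Y (-(Y t * A t)) t := hY
  have hconst : ∀ Z : ℝ → Mt, (∀ t, HasDerivAt Z (A t * Z t) t) → ∀ t, Y t * Z t = Z 0 := by
    intro Z hZ t
    have hd : ∀ t, HasDerivAt (fun t => Y t * Z t) 0 t := by
      intro t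
      convert! (hY t).mul (hZ t) using 1
      rw [neg_mul, mul_assoc, neg_add_cancel]
    have := is_const_of_deriv_eq_zero (fun t => (hd t).differentiableAt) (fun t => (hd t).deriv) t 0
    simpa [hY0] using this
  have hYX : ∀ t, Y t * X t = 1 := fun t => by rw [hconst X hX, hX0]
  have hXY : ∀ t, X t * Y t = 1 := fun t => mul_eq_one_comm.1 (hYX t)
  have hXu : ∀ t, IsUnit (X t) := fun t => ⟨⟨X t, Y t, hXY t, hYX t⟩, rfl⟩
  have hX1 : ∀ t, X (t + 1) = X t * X 1 := by
    intro t
    have := hconst (fun t => X (t + 1)) (fun t => by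
      have := (hX (t + 1)).comp_add_const t 1
      rwa [hAper] at this) t
    simp only [zero_add] at this
    rw [← this, ← mul_assoc, hXY, one_mul]
  obtain ⟨C, hC⟩ := matrix_exists_log n (X 1) (hXu 1)
  have hB : ∀ t : ℝ, HasDerivAt (fun t : ℝ => X t * NormedSpace.exp (t • (-C)))
      (A t * (X t * NormedSpace.exp (t • (-C))) - X t * NormedSpace.exp (t • (-C)) * C) t := by
    intro t
    convert! (hX t).mul (hasDerivAt_exp_smul_const (𝕂 := ℝ) (-C) t) using 1
    noncomm_ring
  refine ⟨C, fun t => X t * NormedSpace.exp (t • (-C)), fun t => (hB t).differentiableAt,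
    fun t => ?_, fun t => ?_, fun t => (hB t).deriv⟩
  · have : (t + 1) • (-C) = -C + t • (-C) := by rw [add_smul, one_smul, add_comm]
    show X (t+1) * _ = _
    rw [this, Matrix.exp_add_of_commute _ _ ((Commute.refl (-C)).smul_right t), hX1, ← hC,
      mul_assoc, ← mul_assoc (NormedSpace.exp C),
      ← Matrix.exp_add_of_commute _ _ ((Commute.refl C).neg_right)]
    simp
  · exact (hXu t).mul (Matrix.isUnit_exp _)
end

section
/- (Classical Liouville theorem.) Let n ≥ 1 and N ∈ ℕ. Let f : ℝⁿ → ℝ be a smooth (C^∞) function that is harmonic, i.e. Σ_{i=1}^{n} ∂²f/∂x_i²(x) = 0 for every x ∈ ℝⁿ, and suppose f has polynomial growth of order N: there is a constant C with |f(x)| ≤ C·(1 + ‖x‖)^N for all x. Then f is a polynomial of degree at most N: there exists a multivariate polynomial p ∈ ℝ[x₁,…,x_n] with total degree ≤ N such that f(x) = p(x) for all x ∈ ℝⁿ. -/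
open MeasureTheory

noncomputable def pd {n : ℕ} (i : Fin n) (g : (Fin n → ℝ) → ℝ) (x : Fin n → ℝ) : ℝ :=
  fderiv ℝ g x (Pi.single i 1)

lemma pd_contDiff {n : ℕ} (i : Fin n) {g : (Fin n → ℝ) → ℝ} (hg : ContDiff ℝ (⊤ : ℕ∞) g) :
    ContDiff ℝ (⊤ : ℕ∞) (pd i g) := by
  unfold pd
  have h : ContDiff ℝ (⊤ : ℕ∞) (fderiv ℝ g) := hg.fderiv_right (by simp)
  exact h.clm_apply contDiff_const

lemma pd_comm {n : ℕ} (i j : Fin n) {g : (Fin n → ℝ) → ℝ} (hg : ContDiff ℝ (⊤ : ℕ∞) g) :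
    pd i (pd j g) = pd j (pd i g) := by
  have h : ContDiff ℝ (⊤ : ℕ∞) (fderiv ℝ g) := hg.fderiv_right (by simp)
  have hd : Differentiable ℝ (fderiv ℝ g) := h.differentiable (by simp)
  have key : ∀ (i j : Fin n) x, pd i (pd j g) x
      = fderiv ℝ (fderiv ℝ g) x (Pi.single i 1) (Pi.single j 1) := by
    intro i j x
    unfold pd
    rw [fderiv_clm_apply (hd x) (by fun_prop)]
    simp
  ext x
  rw [key, key]
  exact (hg.contDiffAt.isSymmSndFDerivAt (by simpa using WithTop.coe_le_coe.mpr (le_top : (2:ℕ∞) ≤ ⊤))).eq _ _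

lemma pd_mul {n : ℕ} (i : Fin n) {f g : (Fin n → ℝ) → ℝ} (hf : ContDiff ℝ (⊤ : ℕ∞) f)
    (hg : ContDiff ℝ (⊤ : ℕ∞) g) (x) :
    pd i (fun y => f y * g y) x = pd i f x * g x + f x * pd i g x := by
  unfold pd
  rw [fderiv_fun_mul (hf.differentiable (by simp) x) (hg.differentiable (by simp) x)]
  simp; ring

def Harm {n : ℕ} (g : (Fin n → ℝ) → ℝ) : Prop := ∀ x, ∑ i, pd i (pd i g) x = 0

lemma Harm.pd {n : ℕ} (j : Fin n) {g : (Fin n → ℝ) → ℝ} (hg : ContDiff ℝ (⊤ : ℕ∞) g)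
    (h : Harm g) : Harm (pd j g) := by
  intro x
  have e : ∀ i, _root_.pd i (_root_.pd i (_root_.pd j g)) = _root_.pd j (_root_.pd i (_root_.pd i g)) := by
    intro i
    rw [pd_comm i j hg, pd_comm i j (pd_contDiff i hg)]
  simp_rw [e]
  have : (fun y => ∑ i, _root_.pd i (_root_.pd i g) y) = fun _ => 0 := funext h
  have h2 : _root_.pd j (fun y => ∑ i, _root_.pd i (_root_.pd i g) y) x = 0 := by
    rw [this]; simp [_root_.pd]
  rw [← h2]
  have hd : ∀ i ∈ Finset.univ, DifferentiableAt ℝ (_root_.pd i (_root_.pd i g)) x := fun i _ =>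
    (pd_contDiff i (pd_contDiff i hg)).differentiable (by simp) x
  change _ = fderiv ℝ (fun y => ∑ i, _root_.pd i (_root_.pd i g) y) x (Pi.single j 1)
  rw [fderiv_fun_sum hd, sum_apply]
  rfl

lemma pd_hcs {n : ℕ} (i : Fin n) {F : (Fin n → ℝ) → ℝ} (hc : HasCompactSupport F) :
    HasCompactSupport (pd i F) := by
  have := hc.fderiv_apply (𝕜 := ℝ) (Pi.single i 1)
  exact this

lemma integral_pd {n : ℕ} (i : Fin n) {F : (Fin n → ℝ) → ℝ} (hF : ContDiff ℝ (⊤ : ℕ∞) F)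
    (hc : HasCompactSupport F) : ∫ x, pd i F x = 0 := by
  have hi : Integrable F := hF.continuous.integrable_of_hasCompactSupport hc
  have hi' : Integrable (pd i F) :=
    (pd_contDiff i hF).continuous.integrable_of_hasCompactSupport (pd_hcs i hc)
  have := integral_mul_fderiv_eq_neg_fderiv_mul_of_integrable (𝕜 := ℝ) (μ := volume)
    (f := fun _ : Fin n → ℝ => (1:ℝ)) (g := F) (v := Pi.single i 1)
    (by simp) (by simp only [one_mul]; exact hi') (by simpa using hi) (by intros; fun_prop)
    (fun x _ => hF.differentiable (by simp) x)
  simpa [pd] using this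

lemma energy {n : ℕ} {g η : (Fin n → ℝ) → ℝ} (hg : ContDiff ℝ (⊤ : ℕ∞) g)
    (hh : Harm g) (hη : ContDiff ℝ (⊤ : ℕ∞) η) (hc : HasCompactSupport η) :
    ∫ x, η x ^ 2 * (∑ i, pd i g x ^ 2) ≤ 4 * ∫ x, g x ^ 2 * ∑ i, pd i η x ^ 2 := by
  have hG : ∀ i, ContDiff ℝ (⊤ : ℕ∞) (pd i g) := fun i => pd_contDiff i hg
  have hcF : ∀ i, HasCompactSupport (fun x => η x * (η x * (g x * pd i g x))) :=
    fun i => hc.mul_right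
  have hsF : ∀ i, ContDiff ℝ (⊤ : ℕ∞) (fun x => η x * (η x * (g x * pd i g x))) :=
    fun i => hη.mul (hη.mul (hg.mul (hG i)))
  have h0 : ∫ x, ∑ i, pd i (fun x => η x * (η x * (g x * pd i g x))) x = 0 := by
    rw [integral_finsetSum]
    · simp [integral_pd _ (hsF _) (hcF _)]
    · intro i _
      exact (pd_contDiff i (hsF i)).continuous.integrable_of_hasCompactSupport (pd_hcs i (hcF i))
  have hpt : ∀ x, η x ^ 2 * (∑ i, pd i g x ^ 2) - 4 * (g x ^ 2 * ∑ i, pd i η x ^ 2)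
      ≤ 2 * ∑ i, pd i (fun x => η x * (η x * (g x * pd i g x))) x := by
    intro x
    have e : ∀ i, pd i (fun x => η x * (η x * (g x * pd i g x))) x
        = η x ^ 2 * pd i g x ^ 2 + 2 * g x * η x * pd i η x * pd i g x
          + η x ^ 2 * g x * pd i (pd i g) x := by
      intro i
      rw [pd_mul i hη (hη.mul (hg.mul (hG i))), pd_mul i hη (hg.mul (hG i)), pd_mul i hg (hG i)]
      ring
    simp_rw [e]
    rw [Finset.sum_add_distrib, ← Finset.mul_sum, hh x, Finset.mul_sum, Finset.mul_sum,
      Finset.mul_sum, ← Finset.sum_sub_distrib, mul_zero, add_zero, Finset.mul_sum]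
    apply Finset.sum_le_sum
    intro i _
    nlinarith [sq_nonneg (η x * pd i g x + 2 * g x * pd i η x)]
  have i1 : Integrable (fun x => η x ^ 2 * (∑ i, pd i g x ^ 2)) := by
    apply Continuous.integrable_of_hasCompactSupport
    · exact (hη.continuous.pow 2).mul
        (continuous_finsetSum _ fun i _ => (hG i).continuous.pow 2)
    · simp_rw [pow_two (η _), mul_assoc]
      exact hc.mul_right
  have i2 : Integrable (fun x => g x ^ 2 * (∑ i, pd i η x ^ 2)) := by
    apply Continuous.integrable_of_hasCompactSupport
    · exact (hg.continuous.pow 2).mul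
        (continuous_finsetSum _ fun i _ => (pd_contDiff i hη).continuous.pow 2)
    · apply HasCompactSupport.mul_left
      refine HasCompactSupport.of_support_subset_isCompact hc ?_
      intro x hx
      by_contra hx'
      apply hx
      apply Finset.sum_eq_zero
      intro i _
      have : pd i η x = 0 := by
        have h1 : x ∉ tsupport (pd i η) := fun h => hx' (by
          have := tsupport_fderiv_apply_subset ℝ (f := η) (Pi.single i 1)
          exact this h)
        exact image_eq_zero_of_notMem_tsupport h1
      simp [this]
  have i3 : Integrable (fun x => 2 * ∑ i, pd i (fun x => η x * (η x * (g x * pd i g x))) x) := by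
    apply Integrable.const_mul
    apply integrable_finsetSum
    intro i _
    exact (pd_contDiff i (hsF i)).continuous.integrable_of_hasCompactSupport (pd_hcs i (hcF i))
  have := integral_mono (i1.sub (i2.const_mul 4)) i3 hpt
  simp only [Pi.sub_apply] at this
  rw [integral_sub i1 (i2.const_mul 4), integral_const_mul, integral_const_mul, h0] at this
  linarith

def Dec {n : ℕ} (a : ℤ) (g : (Fin n → ℝ) → ℝ) : Prop :=
  ∃ C : ℝ, ∀ R : ℝ, 1 ≤ R → ∫ x in Metric.ball (0 : Fin n → ℝ) R, g x ^ 2 ≤ C * R ^ a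

lemma intOn_ball {n : ℕ} {g : (Fin n → ℝ) → ℝ} (hg : Continuous g) (R : ℝ) :
    IntegrableOn g (Metric.ball (0 : Fin n → ℝ) R) :=
  (hg.continuousOn.integrableOn_compact (isCompact_closedBall 0 R)).mono_set
    Metric.ball_subset_closedBall

lemma Dec.pd {n : ℕ} {a : ℤ} {g : (Fin n → ℝ) → ℝ} (hg : ContDiff ℝ (⊤ : ℕ∞) g)
    (hh : Harm g) (hd : Dec a g) (i : Fin n) : Dec (a - 2) (pd i g) := by
  obtain ⟨C, hC⟩ := hd
  let φ : ContDiffBump (0 : Fin n → ℝ) := ⟨1, 2, one_pos, one_lt_two⟩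
  have hφ : ContDiff ℝ (⊤ : ℕ∞) φ := φ.contDiff
  have hφc : HasCompactSupport φ := φ.hasCompactSupport
  have hM : ∃ M : ℝ, ∀ x, ∑ i, _root_.pd i φ x ^ 2 ≤ M := by
    have : ∀ i : Fin n, ∃ M : ℝ, ∀ x, ‖_root_.pd i φ x‖ ≤ M := fun i =>
      (pd_hcs i hφc).exists_bound_of_continuous (pd_contDiff i hφ).continuous
    choose M hM using this
    refine ⟨∑ i, M i ^ 2, fun x => Finset.sum_le_sum fun i _ => ?_⟩
    have := hM i x
    rw [Real.norm_eq_abs] at this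
    exact sq_le_sq' (by linarith [neg_abs_le (_root_.pd i φ x)]) (le_trans (le_abs_self _) this)
  obtain ⟨M, hM⟩ := hM
  have hM0 : 0 ≤ M := le_trans (Finset.sum_nonneg fun i _ => sq_nonneg _) (hM 0)
  refine ⟨4 * M * C * 3 ^ a, fun R hR => ?_⟩
  have hR0 : 0 < R := by linarith
  let η : (Fin n → ℝ) → ℝ := fun x => φ (R⁻¹ • x)
  have hη : ContDiff ℝ (⊤ : ℕ∞) η := hφ.comp (contDiff_const_smul _)
  have hηc : HasCompactSupport η :=
    hφc.comp_homeomorph (Homeomorph.smulOfNeZero R⁻¹ (inv_ne_zero hR0.ne'))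
  have hpdη : ∀ i x, _root_.pd i η x = R⁻¹ * _root_.pd i φ (R⁻¹ • x) := by
    intro i x
    have := fderiv_comp_smul (𝕜 := ℝ) (f := φ) (x := x) R⁻¹
    change fderiv ℝ (fun x => φ (R⁻¹ • x)) x _ = _
    rw [this]
    simp [_root_.pd]
  have hen := energy hg hh hη hηc
  have hG : ContDiff ℝ (⊤ : ℕ∞) (_root_.pd i g) := pd_contDiff i hg
  have s1 : ∫ x in Metric.ball (0 : Fin n → ℝ) R, _root_.pd i g x ^ 2
      ≤ ∫ x, η x ^ 2 * (∑ i, _root_.pd i g x ^ 2) := by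
    rw [← integral_indicator measurableSet_ball]
    apply integral_mono
    · rw [integrable_indicator_iff measurableSet_ball]
      exact intOn_ball (hG.continuous.pow 2) R
    · apply Continuous.integrable_of_hasCompactSupport
      · exact (hη.continuous.pow 2).mul
          (continuous_finsetSum _ fun i _ => (pd_contDiff i hg).continuous.pow 2)
      · simp_rw [pow_two (η _), mul_assoc]
        exact hηc.mul_right
    · intro x
      by_cases hx : x ∈ Metric.ball (0 : Fin n → ℝ) R
      · simp only [Set.indicator_of_mem hx]
        have : η x = 1 := by
          apply φ.one_of_mem_closedBall
          rw [mem_ball_zero_iff] at hx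
          rw [mem_closedBall_zero_iff, norm_smul, norm_inv, Real.norm_of_nonneg hR0.le]
          change R⁻¹ * ‖x‖ ≤ 1
          rw [inv_mul_le_iff₀ hR0]; linarith
        rw [this, one_pow, one_mul]
        exact Finset.single_le_sum (f := fun i => _root_.pd i g x ^ 2)
          (fun i _ => sq_nonneg _) (Finset.mem_univ i)
      · simp only [Set.indicator_of_notMem hx]
        exact mul_nonneg (sq_nonneg _) (Finset.sum_nonneg fun i _ => sq_nonneg _)
  have s2 : ∫ x, g x ^ 2 * ∑ i, _root_.pd i η x ^ 2
      ≤ M * R⁻¹ ^ 2 * ∫ x in Metric.ball (0 : Fin n → ℝ) (3 * R), g x ^ 2 := by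
    rw [← integral_indicator measurableSet_ball, ← integral_const_mul]
    apply integral_mono_of_nonneg
    · exact Filter.Eventually.of_forall fun x =>
        mul_nonneg (sq_nonneg _) (Finset.sum_nonneg fun i _ => sq_nonneg _)
    · apply Integrable.const_mul
      rw [integrable_indicator_iff measurableSet_ball]
      exact intOn_ball (hg.continuous.pow 2) _
    · apply Filter.Eventually.of_forall
      intro x
      simp only [hpdη, mul_pow]
      rw [← Finset.mul_sum]
      by_cases hx : x ∈ Metric.ball (0 : Fin n → ℝ) (3 * R)
      · simp only [Set.indicator_of_mem hx]
        have := mul_le_mul_of_nonneg_left (hM (R⁻¹ • x))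
          (mul_nonneg (sq_nonneg (g x)) (sq_nonneg R⁻¹))
        linarith
      · simp only [Set.indicator_of_notMem hx]
        have h0 : ∀ i, _root_.pd i φ (R⁻¹ • x) = 0 := by
          intro i
          have h1 : R⁻¹ • x ∉ tsupport (_root_.pd i φ) := fun h => by
            have h2 := tsupport_fderiv_apply_subset ℝ (f := φ) (Pi.single i 1) h
            rw [φ.tsupport_eq, mem_closedBall_zero_iff, norm_smul, norm_inv,
              Real.norm_of_nonneg hR0.le, inv_mul_le_iff₀ hR0] at h2
            change _ ≤ R * 2 at h2
            rw [mem_ball_zero_iff] at hx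
            linarith
          exact image_eq_zero_of_notMem_tsupport h1
        simp [h0]
  have s3 := hC (3 * R) (by linarith)
  calc _ ≤ _ := s1
    _ ≤ _ := hen
    _ ≤ 4 * (M * R⁻¹ ^ 2 * (C * (3 * R) ^ a)) := by gcongr; exact s2.trans (by gcongr)
    _ = _ := by
      rw [mul_zpow, zpow_sub₀ hR0.ne']
      simp only [zpow_ofNat]
      field_simp

lemma Dec.zero {n : ℕ} {a : ℤ} (ha : a < 0) {g : (Fin n → ℝ) → ℝ} (hg : Continuous g)
    (hd : Dec a g) (x : Fin n → ℝ) : g x = 0 := by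
  obtain ⟨C, hC⟩ := hd
  have key : ∀ r : ℝ, ∫ x in Metric.ball (0 : Fin n → ℝ) r, g x ^ 2 ≤ 0 := by
    intro r
    have ht : Filter.Tendsto (fun R : ℝ => C * R ^ a) Filter.atTop (nhds 0) := by
      simpa using (tendsto_zpow_atTop_zero ha).const_mul C
    refine ge_of_tendsto ht ?_
    filter_upwards [Filter.eventually_ge_atTop 1, Filter.eventually_ge_atTop r] with R h1 h2
    refine le_trans ?_ (hC R h1)
    exact setIntegral_mono_set (intOn_ball (hg.pow 2) R)
      (Filter.Eventually.of_forall fun x => sq_nonneg _)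
      (Metric.ball_subset_ball h2).eventuallyLE
  by_contra hx
  have hpos : 0 < ∫ x in Metric.ball (0 : Fin n → ℝ) (‖x‖ + 1), g x ^ 2 := by
    rw [integral_pos_iff_support_of_nonneg (fun x => sq_nonneg _) (intOn_ball (hg.pow 2) _)]
    rw [Measure.restrict_apply' measurableSet_ball]
    apply IsOpen.measure_pos
    · exact (hg.pow 2).isOpen_support.inter Metric.isOpen_ball
    · exact ⟨x, by simpa using hx, by simp⟩
  exact absurd (key _) (not_le.mpr hpos)

lemma Dec.base {n N : ℕ} {g : (Fin n → ℝ) → ℝ} (hg : Continuous g) (C : ℝ)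
    (h : ∀ x, |g x| ≤ C * (1 + ‖x‖) ^ N) : Dec (2 * N + n : ℕ) g := by
  have hC0 : 0 ≤ C := by simpa using (abs_nonneg _).trans (h 0)
  refine ⟨(C * 2 ^ N) ^ 2 * 2 ^ n, fun R hR => ?_⟩
  have hR0 : 0 < R := by linarith
  have : ∫ x in Metric.ball (0 : Fin n → ℝ) R, g x ^ 2 ≤
      ∫ x in Metric.ball (0 : Fin n → ℝ) R, (C * (2 * R) ^ N) ^ 2 := by
    apply setIntegral_mono_on (intOn_ball (hg.pow 2) R) (intOn_ball continuous_const R)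
      measurableSet_ball
    intro x hx
    rw [mem_ball_zero_iff] at hx
    rw [Pi.pow_apply, ← sq_abs (g x)]
    gcongr
    refine (h x).trans ?_
    gcongr
    linarith
  refine this.trans (le_of_eq ?_)
  rw [setIntegral_const, Measure.real, Real.volume_pi_ball _ hR0, ENNReal.toReal_ofReal (by positivity)]
  simp only [zpow_natCast, Fintype.card_fin, smul_eq_mul]
  ring

lemma iter_dec {n : ℕ} {a : ℤ} {f : (Fin n → ℝ) → ℝ} (hf : ContDiff ℝ (⊤ : ℕ∞) f)
    (hh : Harm f) (hd : Dec a f) (k : ℕ) : ∀ m : Fin k → Fin n,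
    ContDiff ℝ (⊤ : ℕ∞) (fun y => iteratedFDeriv ℝ k f y (fun i => Pi.single (m i) 1)) ∧
    Harm (fun y => iteratedFDeriv ℝ k f y (fun i => Pi.single (m i) 1)) ∧
    Dec (a - 2 * k) (fun y => iteratedFDeriv ℝ k f y (fun i => Pi.single (m i) 1)) := by
  induction k with
  | zero => intro m; simpa using ⟨hf, hh, hd⟩
  | succ k ih =>
    intro m
    obtain ⟨h1, h2, h3⟩ := ih (fun i => m i.succ)
    have e : (fun y => iteratedFDeriv ℝ (k + 1) f y (fun i => Pi.single (m i) 1)) =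
        pd (m 0) (fun y => iteratedFDeriv ℝ k f y (fun i => Pi.single (m i.succ) 1)) := by
      ext y
      have hdf : DifferentiableAt ℝ (iteratedFDeriv ℝ k f) y :=
        hf.differentiable_iteratedFDeriv (by exact_mod_cast ENat.natCast_lt_top k) y
      rw [hdf.iteratedFDeriv_succ_apply_left']
      rfl
    rw [e]
    refine ⟨pd_contDiff _ h1, h2.pd _ h1, ?_⟩
    have := h3.pd h1 h2 (m 0)
    convert this using 1
    push_cast; ring

lemma cmm_expand {n k : ℕ} (T : ContinuousMultilinearMap ℝ (fun _ : Fin k => (Fin n → ℝ)) ℝ)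
    (x : Fin n → ℝ) : T (fun _ => x) =
      ∑ m : Fin k → Fin n, (∏ i, x (m i)) * T (fun i => Pi.single (m i) 1) := by
  have hx : x = ∑ j, x j • (Pi.single j 1 : Fin n → ℝ) := by
    ext l; simp [Finset.sum_apply, Pi.single_apply]
  conv_lhs => rw [hx]
  rw [T.map_sum (g := fun _ j => x j • (Pi.single j 1 : Fin n → ℝ))]
  refine Finset.sum_congr rfl fun m _ => ?_
  rw [T.map_smul_univ (fun i => x (m i)), smul_eq_mul]

lemma taylor_aux (k : ℕ) : ∀ h : ℝ → ℝ, ContDiff ℝ (⊤ : ℕ∞) h → (∀ t, iteratedDeriv k h t = 0) →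
    ∀ t, h t = ∑ j ∈ Finset.range k, iteratedDeriv j h 0 / (j.factorial : ℝ) * t ^ j := by
  induction k with
  | zero => intro h _ h0 t; simpa using h0 t
  | succ k ih =>
    intro h hs h0 t
    have hs' : ContDiff ℝ (⊤ : ℕ∞) (deriv h) := by
      have := (contDiff_infty_iff_deriv (f := h)).1 hs
      exact this.2
    have ih' := ih (deriv h) hs' (fun t => by rw [← iteratedDeriv_succ']; exact h0 t)
    have key : ∀ t, h t - ∑ j ∈ Finset.range (k + 1), iteratedDeriv j h 0 / (j.factorial : ℝ) * t ^ j
        = h 0 - ∑ j ∈ Finset.range (k + 1), iteratedDeriv j h 0 / (j.factorial : ℝ) * 0 ^ j := by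
      intro t
      apply is_const_of_deriv_eq_zero
        (f := fun t => h t - ∑ j ∈ Finset.range (k + 1), iteratedDeriv j h 0 / (j.factorial : ℝ) * t ^ j)
      · have := hs.differentiable (by simp)
        fun_prop
      · intro s
        have hd : HasDerivAt (fun t => h t - ∑ j ∈ Finset.range (k + 1),
            iteratedDeriv j h 0 / (j.factorial : ℝ) * t ^ j)
            (deriv h s - ∑ j ∈ Finset.range (k + 1),
              iteratedDeriv j h 0 / (j.factorial : ℝ) * (j * s ^ (j - 1))) s := by
          refine HasDerivAt.sub (hs.differentiable (by simp) s).hasDerivAt ?_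
          refine HasDerivAt.fun_sum fun j _ => ?_
          exact (hasDerivAt_pow j s).const_mul _
        rw [hd.deriv, ih' s, Finset.sum_range_succ', sub_eq_zero]
        simp only [Nat.cast_zero, zero_mul, mul_zero, add_zero]
        refine Finset.sum_congr rfl fun j _ => ?_
        rw [iteratedDeriv_succ', Nat.factorial_succ]
        push_cast
        have : (j.factorial : ℝ) ≠ 0 := by positivity
        have : (j : ℝ) + 1 ≠ 0 := by positivity
        field_simp
    have := key t
    rw [Finset.sum_range_succ' (fun j => iteratedDeriv j h 0 / (j.factorial : ℝ) * 0 ^ j)] at this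
    simp at this
    linarith

lemma poly_growth (P : Polynomial ℝ) (N : ℕ) (C b : ℝ)
    (h : ∀ t : ℝ, |P.eval t| ≤ C * (1 + |t| * b) ^ N) (j : ℕ) (hj : N < j) : P.coeff j = 0 := by
  by_contra hne
  have hdeg : (Polynomial.X ^ N : Polynomial ℝ).degree < P.degree := by
    rw [Polynomial.degree_X_pow]
    exact lt_of_lt_of_le (by exact_mod_cast hj) (Polynomial.le_degree_of_ne_zero hne)
  have ht := Polynomial.abs_div_tendsto_atTop_atTop_of_degree_gt P _ hdeg (by simp)
  have h1 := ht.eventually_gt_atTop (|C| * (1 + |b|) ^ N)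
  obtain ⟨t, h1, h2⟩ := (h1.and (Filter.eventually_ge_atTop 1)).exists
  have ht0 : 0 < t := by linarith
  have h3 := h t
  rw [abs_div, Polynomial.eval_pow, Polynomial.eval_X, abs_of_pos (pow_pos ht0 N),
    lt_div_iff₀ (pow_pos ht0 N)] at h1
  have h4 : C * (1 + |t| * b) ^ N ≤ |C| * (1 + |b|) ^ N * t ^ N := by
    refine (le_abs_self _).trans ?_
    rw [abs_mul, abs_pow, mul_assoc, ← mul_pow]
    gcongr
    refine (abs_add_le _ _).trans ?_
    rw [abs_mul, abs_abs, abs_of_pos ht0, abs_one]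
    nlinarith
  linarith

/-- **Classical Liouville theorem**: a smooth harmonic function on `ℝⁿ` with
polynomial growth of order `N` is a polynomial of total degree at most `N`. -/
theorem liouville_harmonic_polynomial_growth (n : ℕ) (hn : 1 ≤ n) (N : ℕ)
    (f : (Fin n → ℝ) → ℝ) (hf : ContDiff ℝ (⊤ : ℕ∞) f)
    (hharm : ∀ x : Fin n → ℝ,
      ∑ i : Fin n, iteratedFDeriv ℝ 2 f x (fun _ => Pi.single i 1) = 0)
    (C : ℝ) (hgrowth : ∀ x : Fin n → ℝ, |f x| ≤ C * (1 + ‖x‖) ^ N) :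
    ∃ p : MvPolynomial (Fin n) ℝ, p.totalDegree ≤ N ∧
      ∀ x : Fin n → ℝ, f x = MvPolynomial.eval x p := by
  have hh : Harm f := by
    intro x
    rw [← hharm x]
    refine Finset.sum_congr rfl fun i _ => ?_
    have hd : Differentiable ℝ (fderiv ℝ f) :=
      (hf.fderiv_right (m := (⊤ : ℕ∞)) (by simp)).differentiable (by simp)
    rw [iteratedFDeriv_two_apply]
    unfold pd
    rw [fderiv_clm_apply (hd x) (by fun_prop)]
    simp
  have hd := Dec.base hf.continuous C hgrowth
  let k := 2 * N + n + 1
  have hz : ∀ y x, iteratedFDeriv ℝ k f y (fun _ => x) = 0 := by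
    intro y x
    rw [cmm_expand]
    apply Finset.sum_eq_zero
    intro m _
    obtain ⟨h1, h2, h3⟩ := iter_dec hf hh hd k m
    rw [h3.zero (by simp only [k]; push_cast; linarith) h1.continuous y, mul_zero]
  have hline : ∀ x j t, iteratedDeriv j (fun t : ℝ => f (t • x)) t
      = iteratedFDeriv ℝ j f (t • x) (fun _ => x) := by
    intro x j t
    have := (ContinuousLinearMap.toSpanSingleton ℝ x).iteratedFDeriv_comp_right hf t
      (i := j) (by exact_mod_cast le_top)
    rw [iteratedDeriv_eq_iteratedFDeriv]
    change iteratedFDeriv ℝ j (f ∘ (ContinuousLinearMap.toSpanSingleton ℝ x)) t _ = _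
    rw [this]
    simp
  let c : (Fin n → ℝ) → ℕ → ℝ := fun x j => iteratedFDeriv ℝ j f 0 (fun _ => x) / (j.factorial : ℝ)
  have htay : ∀ x t, f (t • x) = ∑ j ∈ Finset.range k, c x j * t ^ j := by
    intro x t
    have := taylor_aux k (fun t : ℝ => f (t • x)) (hf.comp (by fun_prop))
      (fun t => by rw [hline]; exact hz _ _) t
    simp only [hline, zero_smul] at this
    exact this
  have hc : ∀ x j, j < k → N < j → c x j = 0 := by
    intro x j hj hNj
    have := poly_growth (∑ j ∈ Finset.range k, Polynomial.C (c x j) * Polynomial.X ^ j) N C ‖x‖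
      (fun t => by
        have h := hgrowth (t • x)
        rw [htay, norm_smul, Real.norm_eq_abs] at h
        simpa [Polynomial.eval_finsetSum] using h) j hNj
    simpa [Polynomial.finsetSum_coeff, Polynomial.coeff_C_mul, Polynomial.coeff_X_pow, hj]
      using this
  refine ⟨∑ j ∈ Finset.range (N + 1), ∑ m : Fin j → Fin n,
    MvPolynomial.C (iteratedFDeriv ℝ j f 0 (fun i => Pi.single (m i) 1) / (j.factorial : ℝ)) *
      ∏ i, MvPolynomial.X (m i), ?_, fun x => ?_⟩
  · refine MvPolynomial.totalDegree_finsetSum_le fun j hj => ?_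
    refine MvPolynomial.totalDegree_finsetSum_le fun m _ => ?_
    refine (MvPolynomial.totalDegree_mul _ _).trans ?_
    rw [MvPolynomial.totalDegree_C, zero_add]
    refine (MvPolynomial.totalDegree_finsetProd _ _).trans ?_
    simp
    have := Finset.mem_range.1 hj
    omega
  · have h1 := htay x 1
    rw [one_smul] at h1
    rw [h1]
    have hsub : Finset.range (N + 1) ⊆ Finset.range k := by
      intro j hj; simp only [Finset.mem_range, k] at *; omega
    rw [← Finset.sum_subset hsub (fun j hj hj' => by
      rw [hc x j (Finset.mem_range.1 hj) (by simpa using hj'), zero_mul])]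
    simp only [map_sum, map_mul, map_prod, MvPolynomial.eval_C, MvPolynomial.eval_X]
    refine Finset.sum_congr rfl fun j _ => ?_
    simp only [c, one_pow, mul_one]
    rw [cmm_expand, Finset.sum_div]
    refine Finset.sum_congr rfl fun m _ => ?_
    ring
end
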